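/- arXiv:2308.04921 — 3 statements merged into one kernel-verified Lean document; each statement's English description precedes it below -/
import Mathlib

section
/- Let D_rp ⊆ ℝ be an interval, let h' : D_rp → ℝ be as induced by a reparametrization ρ_rp satisfying Assumption (A2) (so h' is well-defined and strictly positive outside a finite set and locally integrable on D_rp), let h be a continuous antiderivative of h' and H a continuous antiderivative of h, and set F(z̃) = ⟨1, H(z̃)⟩ on D_rp^N with associated Bregman divergence D_F. Assume that the univariate function z̃ ↦ z̃·h'(z̃) belongs to the class F_{D_rp} = { f locally integrable on D_rp : |∫_z^b f(x) dx| = ∞ for every z ∈ D_rp and every b ∈ {inf D_rp, sup D_rp} ∩ {−∞, +∞} }. Then for every x ∈ D_rp^N and every r ≥ 0, the Bregman ball B_{D_F,r}(x) = {z ∈ D_rp^N : D_F(x, z) ≤ r} is bounded in the Euclidean norm. -/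
open Filter Topology Set
open scoped ENNReal

noncomputable section

/-- Euclidean gradient of `f : ℝ^k → ℝ`: coordinatewise the Fréchet derivative applied to
the standard basis vectors. -/
def grad {k : ℕ} (f : (Fin k → ℝ) → ℝ) (x : Fin k → ℝ) : Fin k → ℝ :=
  fun i => fderiv ℝ f x (Pi.single i 1)

/-- `w` solves the gradient-flow ODE `w' = -∇F(w)` on `[0, T)`, where `T ∈ (0, ∞]` is coded
as an element of `ℝ≥0∞`. -/
def IsGradFlowOn {k : ℕ} (F : (Fin k → ℝ) → ℝ) (T : ℝ≥0∞) (w : ℝ → Fin k → ℝ) : Prop :=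
  ∀ t : ℝ, 0 ≤ t → ENNReal.ofReal t < T →
    HasDerivWithinAt w (-(grad F (w t))) (Set.Ici 0) t

/-- A reparametrized flow is regular if `ρ'` vanishes at some coordinate of `w t` for only
finitely many times `t` in the domain `[0, T)`. -/
def RegularFlow {k : ℕ} (ρ : ℝ → ℝ) (T : ℝ≥0∞) (w : ℝ → Fin k → ℝ) : Prop :=
  {t : ℝ | 0 ≤ t ∧ ENNReal.ofReal t < T ∧ ∃ i, deriv ρ (w t i) = 0}.Finite

/-- The filter of "`t → T` from within `[0,T)`", with `T = ∞` meaning `t → ∞`. -/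
def endFilter (T : ℝ≥0∞) : Filter ℝ :=
  if T = ⊤ then Filter.atTop else nhdsWithin T.toReal (Set.Iio T.toReal)

/-- Entrywise ℓp-norm on `ℝ^k`. -/
def lpNorm {k : ℕ} (p : ℝ) (z : Fin k → ℝ) : ℝ := (∑ i, |z i| ^ p) ^ (1 / p)

/-- Euclidean norm on `ℝ^k`. -/
def euclNorm {k : ℕ} (z : Fin k → ℝ) : ℝ := Real.sqrt (∑ i, (z i) ^ 2)

/-- Bregman divergence associated with `F(z) = ∑ i, H (z i)`, whose gradient is `h = H'`
applied entrywise. -/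
def bregman {k : ℕ} (H h : ℝ → ℝ) (p q : Fin k → ℝ) : ℝ :=
  (∑ i, H (p i)) - (∑ i, H (q i)) - ∑ i, h (q i) * (p i - q i)

/-- Assumption (A3) on the loss function: continuously differentiable, convex in the first
argument, with minimum `0` attained exactly on the diagonal. -/
structure LossA3 {m : ℕ} (L : (Fin m → ℝ) → (Fin m → ℝ) → ℝ) : Prop where
  contDiff : ContDiff ℝ 1 (Function.uncurry L)
  convexOn_fst : ∀ y, ConvexOn ℝ Set.univ fun z => L z y
  nonneg : ∀ z z', 0 ≤ L z z'
  eq_zero_iff : ∀ z z', L z z' = 0 ↔ z = z'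

/-- Assumption (A1) on the link function. -/
structure LinkA1 {m : ℕ} (ρlink : ℝ → ℝ) (y : Fin m → ℝ) : Prop where
  contDiff : ContDiff ℝ 1 ρlink
  injective : Function.Injective ρlink
  mem_image : ∀ j, ∃ x : ℝ, ρlink x = y j

/-- Assumption (A2) on the reparametrization `ρ : ℝ → D` with inverse `ρinv`:
continuously differentiable and invertible, derivative nonzero outside a finite set, and
`([ρ⁻¹]')²` integrable on every compact subset of `D`. -/
structure RepA2 (ρ : ℝ → ℝ) (D : Set ℝ) (ρinv : ℝ → ℝ) : Prop where
  contDiff : ContDiff ℝ 1 ρ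
  mapsTo : ∀ x : ℝ, ρ x ∈ D
  left_inv : ∀ x : ℝ, ρinv (ρ x) = x
  right_inv : ∀ z ∈ D, ρ (ρinv z) = z
  finite_critical : {x : ℝ | deriv ρ x = 0}.Finite
  loc_integrable : ∀ C : Set ℝ, C ⊆ D → IsCompact C →
    MeasureTheory.IntegrableOn (fun z => (deriv ρinv z) ^ 2) C

theorem RepA2.range_eq {ρ ρinv : ℝ → ℝ} {D : Set ℝ} (hA : RepA2 ρ D ρinv) :
    Set.range ρ = D := by
  ext z
  exact ⟨fun ⟨x, hx⟩ => hx ▸ hA.mapsTo x, fun hz => ⟨ρinv z, hA.right_inv z hz⟩⟩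

theorem RepA2.ordConnected {ρ ρinv : ℝ → ℝ} {D : Set ℝ} (hA : RepA2 ρ D ρinv) :
    D.OrdConnected := by
  rw [← hA.range_eq]
  exact (isPreconnected_range hA.contDiff.continuous).ordConnected

theorem RepA2.isOpen {ρ ρinv : ℝ → ℝ} {D : Set ℝ} (hA : RepA2 ρ D ρinv) : IsOpen D := by
  have hinj : Function.Injective ρ := Function.LeftInverse.injective hA.left_inv
  have hoc := hA.ordConnected
  rw [isOpen_iff_mem_nhds]
  intro z hz
  obtain ⟨x, rfl⟩ := hA.range_eq.symm ▸ hz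
  rcases hA.contDiff.continuous.strictMono_of_inj hinj with hm | hm
  · exact mem_of_superset (Icc_mem_nhds (hm (sub_one_lt x)) (hm (lt_add_one x)))
      (hoc.out (hA.mapsTo _) (hA.mapsTo _))
  · exact mem_of_superset (Icc_mem_nhds (hm (lt_add_one x)) (hm (sub_one_lt x)))
      (hoc.out (hA.mapsTo _) (hA.mapsTo _))

/-- A function that is continuous on an interval and has nonnegative, locally integrable
derivative off a finite set is monotone there. -/
theorem monotoneOn_of_hasDerivAt_off_finite {f f' : ℝ → ℝ} {D S : Set ℝ} (hD : D.OrdConnected)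
    (hS : S.Finite) (hf : ContinuousOn f D) (hderiv : ∀ z ∈ D \ S, HasDerivAt f (f' z) z)
    (hnonneg : ∀ z, 0 ≤ f' z)
    (hint : ∀ a ∈ D, ∀ b ∈ D, IntervalIntegrable f' MeasureTheory.volume a b) :
    MonotoneOn f D := by
  intro a ha b hb hab
  have hsub : uIcc a b ⊆ D := hD.uIcc_subset ha hb
  have hFTC := MeasureTheory.integral_eq_of_hasDerivAt_off_countable f f' hS.countable
    (hf.mono hsub) (fun z hz => hderiv z ⟨hsub (Ioo_subset_Icc_self hz.1), hz.2⟩)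
    (hint a ha b hb)
  have := intervalIntegral.integral_nonneg (μ := MeasureTheory.volume) hab
    (fun u _ => hnonneg u)
  linarith

/-- The tangent line inequality for a function with monotone derivative. -/
theorem tangent_le_of_monotoneOn {H h : ℝ → ℝ} {D : Set ℝ} (hD : D.OrdConnected)
    (hH : ∀ z ∈ D, HasDerivAt H (h z) z) (hmono : MonotoneOn h D) {p q : ℝ} (hp : p ∈ D)
    (hq : q ∈ D) : 0 ≤ H p - H q - h q * (p - q) := by
  rcases lt_trichotomy p q with hpq | rfl | hpq
  · have hsub : Icc p q ⊆ D := hD.out hp hq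
    obtain ⟨c, hc, hceq⟩ := exists_hasDerivAt_eq_slope H h hpq
      (fun z hz => (hH z (hsub hz)).continuousAt.continuousWithinAt)
      (fun z hz => hH z (hsub (Ioo_subset_Icc_self hz)))
    rw [eq_div_iff (by linarith)] at hceq
    have := hmono (hsub (Ioo_subset_Icc_self hc)) hq hc.2.le
    nlinarith
  · simp
  · have hsub : Icc q p ⊆ D := hD.out hq hp
    obtain ⟨c, hc, hceq⟩ := exists_hasDerivAt_eq_slope H h hpq
      (fun z hz => (hH z (hsub hz)).continuousAt.continuousWithinAt)
      (fun z hz => hH z (hsub (Ioo_subset_Icc_self hz)))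
    rw [eq_div_iff (by linarith)] at hceq
    have := hmono hq (hsub (Ioo_subset_Icc_self hc)) hc.1.le
    nlinarith

/-- Integration by parts: the univariate Bregman divergence controls the integral of
`u ↦ u * h'(u)` away from the origin. -/
theorem abs_integral_le_bregman {H h h' : ℝ → ℝ} {D S : Set ℝ} (hD : D.OrdConnected)
    (hS : S.Finite) (hh : ContinuousOn h D) (hderiv : ∀ z ∈ D \ S, HasDerivAt h (h' z) z)
    (hint : ∀ a ∈ D, ∀ b ∈ D, IntervalIntegrable h' MeasureTheory.volume a b)
    (hH : ∀ z ∈ D, HasDerivAt H (h z) z) (hmono : MonotoneOn h D) {x a z : ℝ} (hx : x ∈ D)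
    (ha : a ∈ D) (hz : z ∈ D) (hxa : 2 * |x| ≤ |a|) (haz : 0 ≤ a * (z - a)) :
    |∫ u in a..z, u * h' u| ≤ 2 * (H x - H z - h z * (x - z)) := by
  have hsub : uIcc a z ⊆ D := hD.uIcc_subset ha hz
  have hFTC := MeasureTheory.integral_eq_of_hasDerivAt_off_countable
    (fun u => u * h u - H u) (fun u => u * h' u) hS.countable
    ((continuousOn_id.mul (hh.mono hsub)).sub
      fun u hu => (hH u (hsub hu)).continuousAt.continuousWithinAt)
    (fun u hu => by
      have huD := hsub (Ioo_subset_Icc_self hu.1)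
      have := ((hasDerivAt_id u).mul (hderiv u ⟨huD, hu.2⟩)).sub (hH u huD)
      exact this.congr_deriv (by simp))
    ((hint a ha z hz).continuousOn_mul continuousOn_id)
  have hza := tangent_le_of_monotoneOn hD hH hmono ha hz
  have hxa0 := tangent_le_of_monotoneOn hD hH hmono hx ha
  have hkey : 2 * (x * (h z - h a)) ≤ a * (h z - h a) ∧ 0 ≤ a * (h z - h a) := by
    have hpos : 0 ≤ a * (h z - h a) := by
      rcases lt_trichotomy a 0 with h0 | h0 | h0
      · have : z ≤ a := by nlinarith
        nlinarith [hmono hz ha this]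
      · simp [h0]
      · have : a ≤ z := by nlinarith
        nlinarith [hmono ha hz this]
    refine ⟨?_, hpos⟩
    calc 2 * (x * (h z - h a)) ≤ 2 * |x * (h z - h a)| := by gcongr; exact le_abs_self _
      _ = (2 * |x|) * |h z - h a| := by rw [abs_mul]; ring
      _ ≤ |a| * |h z - h a| := by gcongr
      _ = a * (h z - h a) := by rw [← abs_mul, abs_of_nonneg hpos]
  rw [hFTC, abs_of_nonneg (by nlinarith)]
  nlinarith

/-- If `z ↦ z·h'(z)` has divergent improper integrals towards every
infinite endpoint of `D_rp`, then all Bregman balls of `F(z) = ⟨1, H(z)⟩` are bounded. -/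
theorem statement11 {N : ℕ} (ρ ρinv : ℝ → ℝ) (D : Set ℝ) (hA2 : RepA2 ρ D ρinv)
    (h H : ℝ → ℝ) (S : Set ℝ) (hS : S.Finite)
    (hcont : ContinuousOn h D) (hHcont : ContinuousOn H D)
    (hderiv : ∀ z ∈ D \ S,
      HasDerivWithinAt h ((deriv ρinv z) ^ 2) D z ∧ 0 < (deriv ρinv z) ^ 2)
    (hHderiv : ∀ z ∈ D, HasDerivWithinAt H (h z) D z)
    (hdivTop : ¬ BddAbove D → ∀ z ∈ D,
      Tendsto (fun c => |∫ x in z..c, x * (deriv ρinv x) ^ 2|) atTop atTop)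
    (hdivBot : ¬ BddBelow D → ∀ z ∈ D,
      Tendsto (fun c => |∫ x in z..c, x * (deriv ρinv x) ^ 2|) atBot atTop) :
    ∀ x : Fin N → ℝ, (∀ i, x i ∈ D) → ∀ r : ℝ, 0 ≤ r →
      ∃ C : ℝ, ∀ z : Fin N → ℝ, (∀ i, z i ∈ D) → bregman H h x z ≤ r → euclNorm z ≤ C := by
  have hD := hA2.ordConnected
  have hnhds : ∀ z ∈ D, D ∈ 𝓝 z := fun z hz => hA2.isOpen.mem_nhds hz
  have hh : ∀ z ∈ D \ S, HasDerivAt h ((deriv ρinv z) ^ 2) z :=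
    fun z hz => (hderiv z hz).1.hasDerivAt (hnhds z hz.1)
  have hH : ∀ z ∈ D, HasDerivAt H (h z) z := fun z hz => (hHderiv z hz).hasDerivAt (hnhds z hz)
  have hint : ∀ a ∈ D, ∀ b ∈ D,
      IntervalIntegrable (fun z => (deriv ρinv z) ^ 2) MeasureTheory.volume a b :=
    fun a ha b hb => MeasureTheory.IntegrableOn.intervalIntegrable
      (hA2.loc_integrable _ (hD.uIcc_subset ha hb) isCompact_uIcc)
  have hmono : MonotoneOn h D :=
    monotoneOn_of_hasDerivAt_off_finite hD hS hcont hh (fun _ => sq_nonneg _) hint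
  intro x hx r _
  have htop : ∀ y ∈ D, ∃ K : ℝ, ∀ z ∈ D, H y - H z - h z * (y - z) ≤ r → z ≤ K := by
    intro y hy
    by_cases hb : BddAbove D
    · obtain ⟨K, hK⟩ := hb
      exact ⟨K, fun z hz _ => hK hz⟩
    obtain ⟨a, ha, hya⟩ := not_bddAbove_iff.1 hb (2 * |y|)
    obtain ⟨K, hK⟩ := eventually_atTop.1 ((hdivTop hb a ha).eventually_gt_atTop (2 * r))
    refine ⟨max a K, fun z hz hzr => ?_⟩
    by_contra! hlt
    have ha0 : 0 ≤ a := by linarith [abs_nonneg y]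
    have := abs_integral_le_bregman hD hS hcont hh hint hH hmono hy ha hz
      (hya.le.trans (le_abs_self a))
      (mul_nonneg ha0 (by linarith [le_max_left a K]))
    linarith [hK z (by linarith [le_max_right a K])]
  have hbot : ∀ y ∈ D, ∃ K : ℝ, ∀ z ∈ D, H y - H z - h z * (y - z) ≤ r → K ≤ z := by
    intro y hy
    by_cases hb : BddBelow D
    · obtain ⟨K, hK⟩ := hb
      exact ⟨K, fun z hz _ => hK hz⟩
    obtain ⟨a, ha, hya⟩ := not_bddBelow_iff.1 hb (-(2 * |y|))
    obtain ⟨K, hK⟩ := eventually_atBot.1 ((hdivBot hb a ha).eventually_gt_atTop (2 * r))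
    refine ⟨min a K, fun z hz hzr => ?_⟩
    by_contra! hlt
    have ha0 : a ≤ 0 := by linarith [abs_nonneg y]
    have := abs_integral_le_bregman hD hS hcont hh hint hH hmono hy ha hz
      (by linarith [neg_le_abs a])
      (mul_nonneg_of_nonpos_of_nonpos ha0 (by linarith [min_le_left a K]))
    linarith [hK z (by linarith [min_le_right a K])]
  choose U hU using fun i => htop (x i) (hx i)
  choose L hL using fun i => hbot (x i) (hx i)
  refine ⟨Real.sqrt (∑ i, ((L i) ^ 2 + (U i) ^ 2)), fun z hz hzr => ?_⟩
  refine Real.sqrt_le_sqrt (Finset.sum_le_sum fun i _ => ?_)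
  have hsum : bregman H h x z = ∑ i, (H (x i) - H (z i) - h (z i) * (x i - z i)) := by
    simp [bregman, Finset.sum_sub_distrib]
  have hi : H (x i) - H (z i) - h (z i) * (x i - z i) ≤ r := by
    refine le_trans ?_ (hsum ▸ hzr)
    exact Finset.single_le_sum
      (f := fun i => H (x i) - H (z i) - h (z i) * (x i - z i))
      (fun j _ => tangent_le_of_monotoneOn hD hH hmono (hx j) (hz j)) (Finset.mem_univ i)
  have h1 := hU i (z i) (hz i) hi
  have h2 := hL i (z i) (hz i) hi
  rcases le_total 0 (z i) with h0 | h0 <;> nlinarith [sq_nonneg (L i), sq_nonneg (U i)]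
end
end

section
/- Let ρ_rp(z) = sign(z)|z|^{2/p} with p ∈ (1,2), and let w : [0,T) → ℝ^N with T ∈ (0,∞] be any regular reparametrized gradient flow for A ∈ ℝ^{M×N}, y ∈ ℝ^M, with ρ_link and L satisfying Assumptions (A1) and (A3), and with initialization satisfying w̃₀ = ρ_rp(w₀) = α·1 for some α > 0. Set μ := min{‖z̃‖_p : z̃ ∈ ℝ^N, 𝓛̃(z̃) = 0}. If the limit w̃_{T,α} := lim_{t→T} ρ_rp(w(t)) exists with 𝓛̃(w̃_{T,α}) = 0, and if α ≤ μ / (2^{1/(p−1)} N^{1/p}), then ‖w̃_{T,α}‖_p ≤ (1 + 4 N^{1−1/p} (α/μ)^{p−1}) · μ. -/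
open Filter Topology Set
open scoped ENNReal

noncomputable section

/-- The reparametrization `ρ(z) = sign(z) |z|^{2/p}`. -/
def rhoPoly (p z : ℝ) : ℝ := Real.sign z * |z| ^ (2 / p)

/-- The signed power `z ↦ sign(z) |z|^r`. -/
def signedPow (r z : ℝ) : ℝ := Real.sign z * |z| ^ r

lemma signedPow_of_pos {r z : ℝ} (hz : 0 < z) : signedPow r z = z ^ r := by
  simp [signedPow, Real.sign_of_pos hz, abs_of_pos hz]

lemma signedPow_of_neg {r z : ℝ} (hz : z < 0) : signedPow r z = -(-z) ^ r := by
  simp [signedPow, Real.sign_of_neg hz, abs_of_neg hz]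

@[simp] lemma signedPow_zero (r : ℝ) : signedPow r 0 = 0 := by simp [signedPow]

lemma abs_signedPow {r : ℝ} (hr : 0 < r) (z : ℝ) : |signedPow r z| = |z| ^ r := by
  rcases lt_trichotomy z 0 with hz | rfl | hz
  · rw [signedPow_of_neg hz, abs_neg, abs_of_neg hz, abs_of_nonneg]
    exact Real.rpow_nonneg (by linarith) _
  · simp [Real.zero_rpow hr.ne']
  · rw [signedPow_of_pos hz, abs_of_pos hz, abs_of_nonneg (Real.rpow_nonneg hz.le _)]

lemma mul_signedPow_sub_one {p : ℝ} (hp : 1 < p) (z : ℝ) : z * signedPow (p - 1) z = |z| ^ p := by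
  rcases lt_trichotomy z 0 with hz | rfl | hz
  · rw [signedPow_of_neg hz, abs_of_neg hz, Real.rpow_sub_one (by linarith)]
    have := hz.ne
    field_simp
  · simp [Real.zero_rpow (by linarith : p ≠ 0)]
  · rw [signedPow_of_pos hz, abs_of_pos hz, Real.rpow_sub_one hz.ne']
    field_simp

lemma signedPow_signedPow (r s z : ℝ) :
    signedPow r (signedPow s z) = signedPow (s * r) z := by
  rcases lt_trichotomy z 0 with hz | rfl | hz
  · have h : 0 < (-z) ^ s := Real.rpow_pos_of_pos (by linarith) _
    rw [signedPow_of_neg hz, signedPow_of_neg (by linarith), signedPow_of_neg hz, neg_neg,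
      Real.rpow_mul (by linarith)]
  · simp
  · rw [signedPow_of_pos hz, signedPow_of_pos (Real.rpow_pos_of_pos hz _), signedPow_of_pos hz,
      Real.rpow_mul hz.le]

lemma hasDerivAt_signedPow_of_ne_zero (r : ℝ) {z : ℝ} (hz : z ≠ 0) :
    HasDerivAt (signedPow r) (r * |z| ^ (r - 1)) z := by
  rcases hz.lt_or_gt with hz | hz
  · have h : HasDerivAt (fun x : ℝ => -(-x) ^ r) (r * |z| ^ (r - 1)) z := by
      have := ((hasDerivAt_neg z).rpow_const (p := r) (Or.inl (by linarith))).neg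
      rw [abs_of_neg hz]
      exact this.congr_deriv (by ring)
    refine h.congr_of_eventuallyEq ?_
    filter_upwards [Iio_mem_nhds hz] with x hx using signedPow_of_neg hx
  · have h : HasDerivAt (fun x : ℝ => x ^ r) (r * |z| ^ (r - 1)) z := by
      rw [abs_of_pos hz]
      exact Real.hasDerivAt_rpow_const (Or.inl hz.ne')
    refine h.congr_of_eventuallyEq ?_
    filter_upwards [Ioi_mem_nhds hz] with x hx using signedPow_of_pos hx

lemma continuous_signedPow {r : ℝ} (hr : 0 < r) : Continuous (signedPow r) := by
  rw [continuous_iff_continuousAt]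
  intro z
  by_cases hz : z = 0
  · subst hz
    have h : Tendsto (fun x : ℝ => |x| ^ r) (𝓝 0) (𝓝 0) := by
      have := (continuous_abs.rpow_const fun x => Or.inr hr.le).tendsto (0 : ℝ)
      simpa [Real.zero_rpow hr.ne'] using this
    rw [ContinuousAt, signedPow_zero]
    exact squeeze_zero_norm (fun x => (abs_signedPow hr x).le) h
  · exact (hasDerivAt_signedPow_of_ne_zero r hz).continuousAt

lemma hasDerivAt_signedPow {r : ℝ} (hr : 1 < r) (z : ℝ) :
    HasDerivAt (signedPow r) (r * |z| ^ (r - 1)) z := by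
  by_cases hz : z = 0
  · subst hz
    rw [abs_zero, Real.zero_rpow (by linarith), mul_zero, hasDerivAt_iff_tendsto_slope]
    have h : Tendsto (fun x : ℝ => |x| ^ (r - 1)) (𝓝[≠] 0) (𝓝 0) := by
      have := (continuous_abs.rpow_const (p := r - 1)
        fun x => Or.inr (by linarith : (0 : ℝ) ≤ r - 1)).tendsto (0 : ℝ)
      rw [abs_zero, Real.zero_rpow (by linarith)] at this
      exact this.mono_left nhdsWithin_le_nhds
    refine squeeze_zero_norm' ?_ h
    filter_upwards [self_mem_nhdsWithin] with x hx
    have hx : x ≠ 0 := hx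
    rw [slope_def_field, signedPow_zero, sub_zero, sub_zero, Real.norm_eq_abs, abs_div,
      abs_signedPow (by linarith), Real.rpow_sub_one (abs_ne_zero.mpr hx)]
  · exact hasDerivAt_signedPow_of_ne_zero r hz

lemma rhoPoly_eq_signedPow (p : ℝ) : rhoPoly p = signedPow (2 / p) := rfl

/-- Chain rule for the gradient of a function precomposed with an entrywise reparametrization. -/
lemma grad_comp_entrywise {k : ℕ} {F : (Fin k → ℝ) → ℝ} (hF : Differentiable ℝ F) {ρ ρ' : ℝ → ℝ}
    (hρ : ∀ x, HasDerivAt ρ (ρ' x) x) (z : Fin k → ℝ) (i : Fin k) :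
    grad (fun x => F fun j => ρ (x j)) z i
      = ρ' (z i) * fderiv ℝ F (fun j => ρ (z j)) (Pi.single i 1) := by
  have hE : HasFDerivAt (fun (x : Fin k → ℝ) (j : Fin k) => ρ (x j))
      (ContinuousLinearMap.pi fun j =>
        (ρ' (z j)) • (ContinuousLinearMap.proj (R := ℝ) (φ := fun _ : Fin k => ℝ) j)) z :=
    hasFDerivAt_pi.mpr fun j => (hρ (z j)).comp_hasFDerivAt z (hasFDerivAt_apply j z)
  have hC := (hF (fun j => ρ (z j))).hasFDerivAt.comp z hE
  have hs : (fun j => ρ' (z j) * (Pi.single i (1 : ℝ) : Fin k → ℝ) j)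
      = ρ' (z i) • (Pi.single i 1 : Fin k → ℝ) := by
    ext j
    by_cases hj : j = i
    · subst hj; simp
    · simp [hj]
  have h1 : grad (fun x => F fun j => ρ (x j)) z i
      = fderiv ℝ F (fun j => ρ (z j)) (fun j => ρ' (z j) * (Pi.single i (1 : ℝ) : Fin k → ℝ) j) := by
    unfold grad
    have h2 : fderiv ℝ (fun x => F fun j => ρ (x j)) z = _ := hC.fderiv
    rw [h2]
    rfl
  rw [h1, hs, map_smul, smul_eq_mul]

/-- The differential of a function of `A z` vanishes on the kernel of `A`. -/
lemma sum_mul_fderiv_comp_mulVec_eq_zero {N M : ℕ} {G : (Fin M → ℝ) → ℝ} (hG : Differentiable ℝ G)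
    (A : Matrix (Fin M) (Fin N) ℝ) {n : Fin N → ℝ} (hn : A.mulVec n = 0) (z : Fin N → ℝ) :
    ∑ i, n i * fderiv ℝ (fun x => G (A.mulVec x)) z (Pi.single i 1) = 0 := by
  have hA : HasFDerivAt (fun x : Fin N → ℝ => A.mulVec x)
      (LinearMap.toContinuousLinearMap A.mulVecLin) z :=
    (LinearMap.toContinuousLinearMap A.mulVecLin).hasFDerivAt
  have hC := (hG (A.mulVec z)).hasFDerivAt.comp z hA
  have h2 : fderiv ℝ (fun x => G (A.mulVec x)) z = _ := hC.fderiv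
  have hsum : n = ∑ i, n i • (Pi.single i 1 : Fin N → ℝ) := by
    simpa [← Pi.single_smul] using (Finset.univ_sum_single n).symm
  have h3 : ∑ i, n i * fderiv ℝ (fun x => G (A.mulVec x)) z (Pi.single i 1)
      = fderiv ℝ (fun x => G (A.mulVec x)) z n := by
    conv_rhs => rw [hsum]
    simp
  rw [h3, h2]
  simp [hn]

lemma lpNorm_nonneg {k : ℕ} (p : ℝ) (z : Fin k → ℝ) : 0 ≤ lpNorm p z :=
  Real.rpow_nonneg (Finset.sum_nonneg fun _ _ => Real.rpow_nonneg (abs_nonneg _) _) _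

lemma lpNorm_rpow {k : ℕ} {p : ℝ} (hp : p ≠ 0) (z : Fin k → ℝ) (r : ℝ) :
    lpNorm p z ^ r = (∑ i, |z i| ^ p) ^ (r / p) := by
  rw [lpNorm, ← Real.rpow_mul (Finset.sum_nonneg fun _ _ => Real.rpow_nonneg (abs_nonneg _) _)]
  congr 1
  field_simp

lemma sum_mul_signedPow_le {k : ℕ} {p : ℝ} (hp : 1 < p) (z x : Fin k → ℝ) :
    ∑ i, z i * signedPow (p - 1) (x i) ≤ lpNorm p z * lpNorm p x ^ (p - 1) := by
  have hpq : p.HolderConjugate (p / (p - 1)) := Real.HolderConjugate.conjExponent hp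
  have h := Real.inner_le_Lp_mul_Lq Finset.univ z (fun i => signedPow (p - 1) (x i)) hpq
  have hp1 : p - 1 ≠ 0 := by linarith
  have e : ∀ i, |signedPow (p - 1) (x i)| ^ (p / (p - 1)) = |x i| ^ p := fun i => by
    rw [abs_signedPow (by linarith), ← Real.rpow_mul (abs_nonneg _), mul_div_cancel₀ _ hp1]
  simp only [e, one_div_div] at h
  rwa [lpNorm_rpow (by linarith)]

lemma sum_abs_le_lpNorm {k : ℕ} {p : ℝ} (hp : 1 < p) (z : Fin k → ℝ) :
    ∑ i, |z i| ≤ (k : ℝ) ^ (1 - 1 / p) * lpNorm p z := by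
  have hpq : p.HolderConjugate (p / (p - 1)) := Real.HolderConjugate.conjExponent hp
  have h := Real.inner_le_Lp_mul_Lq Finset.univ (fun i => |z i|) (fun _ => (1 : ℝ)) hpq
  have e : (p - 1) / p = 1 - 1 / p := by
    have : p ≠ 0 := by linarith
    field_simp
  simp only [mul_one, abs_abs, abs_one, Real.one_rpow, Finset.sum_const, Finset.card_univ,
    Fintype.card_fin, nsmul_eq_mul, one_div_div, e] at h
  rw [mul_comm]
  exact h

lemma endFilter_neBot {T : ℝ≥0∞} : (endFilter T).NeBot := by
  unfold endFilter
  split_ifs <;> infer_instance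

lemma eventually_endFilter_mem_domain {T : ℝ≥0∞} (hT : 0 < T) :
    ∀ᶠ t in endFilter T, 0 ≤ t ∧ ENNReal.ofReal t < T := by
  unfold endFilter
  split_ifs with h
  · filter_upwards [eventually_ge_atTop 0] with t ht
    exact ⟨ht, by simp [h]⟩
  · have hpos : 0 < T.toReal := ENNReal.toReal_pos hT.ne' h
    filter_upwards [self_mem_nhdsWithin, mem_nhdsWithin_of_mem_nhds (Ioi_mem_nhds hpos)]
      with t ht ht0
    exact ⟨le_of_lt ht0, (ENNReal.ofReal_lt_iff_lt_toReal (le_of_lt ht0) h).mpr ht⟩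

/-- Along a regular flow for the reparametrization `sign(z) |z|^{2/p}`, the mirror variables
`sign(z̃) |z̃|^{p-1}` tested against the kernel of `A` are conserved. -/
lemma sum_mul_signedPow_conserved {N M : ℕ} {p : ℝ} (hp1 : 1 < p) (hp2 : p < 2)
    (A : Matrix (Fin M) (Fin N) ℝ) {G : (Fin M → ℝ) → ℝ} (hG : Differentiable ℝ G)
    {T : ℝ≥0∞} {w : ℝ → Fin N → ℝ}
    (hflow : IsGradFlowOn (fun z => G (A.mulVec fun i => rhoPoly p (z i))) T w)
    (hreg : RegularFlow (rhoPoly p) T w) {n : Fin N → ℝ} (hn : A.mulVec n = 0)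
    {t : ℝ} (ht : 0 ≤ t) (htT : ENNReal.ofReal t < T) :
    ∑ i, n i * signedPow (p - 1) (rhoPoly p (w t i))
      = ∑ i, n i * signedPow (p - 1) (rhoPoly p (w 0 i)) := by
  have hr : 1 < 2 / p := by rw [lt_div_iff₀ (by linarith)]; linarith
  have hq : 0 < 2 / p * (p - 1) := mul_pos (by linarith) (by linarith)
  simp only [rhoPoly_eq_signedPow, signedPow_signedPow]
  have hlt : ∀ s ∈ Icc 0 t, ENNReal.ofReal s < T := fun s hs =>
    (ENNReal.ofReal_le_ofReal hs.2).trans_lt htT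
  have hF : Differentiable ℝ fun x : Fin N → ℝ => G (A.mulVec x) :=
    hG.comp (LinearMap.toContinuousLinearMap A.mulVecLin).differentiable
  have hcont : ContinuousOn (fun s => ∑ i, n i * signedPow (2 / p * (p - 1)) (w s i)) (Icc 0 t) := by
    refine continuousOn_finsetSum _ fun i _ => continuousOn_const.mul ?_
    refine (continuous_signedPow hq).comp_continuousOn ?_
    refine (continuous_apply i).comp_continuousOn fun s hs => ?_
    exact (hflow s hs.1 (hlt s hs)).continuousWithinAt.mono fun x hx => hx.1
  have hderiv : ∀ s ∈ Ioo 0 t \ {t : ℝ | 0 ≤ t ∧ ENNReal.ofReal t < T ∧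
      ∃ i, deriv (rhoPoly p) (w t i) = 0},
      HasDerivAt (fun s => ∑ i, n i * signedPow (2 / p * (p - 1)) (w s i)) 0 s := by
    rintro s ⟨hs, hs'⟩
    have hsT := hlt s ⟨hs.1.le, hs.2.le⟩
    have hw : ∀ i, w s i ≠ 0 := fun i hi => hs' ⟨hs.1.le, hsT, i, by
      rw [hi, rhoPoly_eq_signedPow, (hasDerivAt_signedPow hr 0).deriv, abs_zero,
        Real.zero_rpow (by linarith), mul_zero]⟩
    have hd := (hflow s hs.1.le hsT).hasDerivAt (Ici_mem_nhds hs.1)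
    rw [hasDerivAt_pi] at hd
    have hsum := HasDerivAt.fun_sum (u := Finset.univ) fun i _ =>
      ((hasDerivAt_signedPow_of_ne_zero (2 / p * (p - 1)) (hw i)).comp s (hd i)).const_mul (n i)
    refine hsum.congr_deriv ?_
    have key := sum_mul_fderiv_comp_mulVec_eq_zero hG A hn (fun j => rhoPoly p (w s j))
    rw [← mul_eq_zero_of_right (-(2 / p * (p - 1) * (2 / p))) key, Finset.mul_sum]
    refine Finset.sum_congr rfl fun i _ => ?_
    have hg := grad_comp_entrywise hF (ρ := rhoPoly p) (hasDerivAt_signedPow hr) (w s) i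
    rw [Pi.neg_apply, hg]
    have hab : |w s i| ^ (2 / p * (p - 1) - 1) * |w s i| ^ (2 / p - 1) = 1 := by
      rw [← Real.rpow_add (abs_pos.mpr (hw i))]
      have : 2 / p * (p - 1) - 1 + (2 / p - 1) = 0 := by
        have : p ≠ 0 := by linarith
        field_simp
        ring
      rw [this, Real.rpow_zero]
    linear_combination (-(2 / p * (p - 1) * (2 / p)) * n i *
      fderiv ℝ (fun x : Fin N → ℝ => G (A.mulVec x)) (fun j => rhoPoly p (w s j))
        (Pi.single i 1)) * hab
  have hint := MeasureTheory.integral_eq_of_hasDerivAt_off_countable_of_le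
    (fun s => ∑ i, n i * signedPow (2 / p * (p - 1)) (w s i)) (fun _ => (0 : ℝ)) ht
    hreg.countable hcont hderiv intervalIntegrable_const
  rw [intervalIntegral.integral_zero] at hint
  exact (sub_eq_zero.mp hint.symm)

/-- The `ℓp`-estimate that follows from the optimality condition on the limit. -/
lemma lpNorm_rpow_le_of_sum_eq {N : ℕ} {p α : ℝ} (hp : 1 < p) (hα : 0 < α) {x z : Fin N → ℝ}
    (h : ∑ i, (x i - z i) * signedPow (p - 1) (x i) = ∑ i, (x i - z i) * α ^ (p - 1)) :
    lpNorm p x ^ p ≤ lpNorm p z * lpNorm p x ^ (p - 1)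
      + α ^ (p - 1) * (N : ℝ) ^ (1 - 1 / p) * (lpNorm p x + lpNorm p z) := by
  have h1 : lpNorm p x ^ p = ∑ i, x i * signedPow (p - 1) (x i) := by
    rw [lpNorm_rpow (by linarith), div_self (by linarith), Real.rpow_one]
    exact Finset.sum_congr rfl fun i _ => (mul_signedPow_sub_one hp _).symm
  have h2 : ∑ i, (x i - z i) ≤ (N : ℝ) ^ (1 - 1 / p) * (lpNorm p x + lpNorm p z) := by
    calc ∑ i, (x i - z i) ≤ ∑ i, (|x i| + |z i|) := Finset.sum_le_sum fun i _ => by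
          linarith [le_abs_self (x i), neg_abs_le (z i)]
      _ ≤ _ := by
          rw [Finset.sum_add_distrib, mul_add]
          exact add_le_add (sum_abs_le_lpNorm hp x) (sum_abs_le_lpNorm hp z)
  have h3 := mul_le_mul_of_nonneg_left h2 (Real.rpow_nonneg hα.le (p - 1))
  have h4 := sum_mul_signedPow_le hp z x
  rw [← Finset.sum_mul] at h
  simp only [sub_mul, Finset.sum_sub_distrib] at h h3
  rw [h1]
  linarith

/-- The scalar inequality behind the quantitative bound. -/
lemma le_of_rpow_le {p X m b : ℝ} (hp : 1 < p) (hm : 0 < m) (hb : 0 ≤ b)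
    (hbm : b ≤ m ^ (p - 1) / 2) (h : X ^ p ≤ m * X ^ (p - 1) + b * (X + m)) :
    X ≤ (1 + 4 * (b / m ^ (p - 1))) * m := by
  have hmp : 0 < m ^ (p - 1) := Real.rpow_pos_of_pos hm _
  set e := b / m ^ (p - 1) with he
  have hbe : b = e * m ^ (p - 1) := by rw [he]; field_simp
  have he0 : 0 ≤ e := div_nonneg hb hmp.le
  have he2 : e ≤ 1 / 2 := by rw [he, div_le_iff₀ hmp]; linarith
  by_contra! hX
  have hXm : m < X := by nlinarith [mul_nonneg he0 hm.le]
  have hXp : m ^ (p - 1) ≤ X ^ (p - 1) := Real.rpow_le_rpow hm.le hXm.le (by linarith)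
  have hsplit : X ^ p = X * X ^ (p - 1) := by
    rw [Real.rpow_sub_one (by linarith)]
    have : X ≠ 0 := by linarith
    field_simp
  have h1 : m ^ (p - 1) * (X - m) ≤ m ^ (p - 1) * (e * (X + m)) := by
    have := mul_le_mul_of_nonneg_right hXp (by linarith : 0 ≤ X - m)
    rw [hsplit, hbe] at h
    linarith
  have h2 := le_of_mul_le_mul_left h1 hmp
  nlinarith [mul_nonneg he0 hm.le, mul_nonneg (by linarith : 0 ≤ 1 / 2 - e) (by linarith : 0 ≤ X - m)]

/-- Polynomial regularization: quantitative ℓp-bound on the limit of the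
reparametrized flow. -/
theorem statement12 {N M : ℕ} (p α : ℝ) (hp1 : 1 < p) (hp2 : p < 2) (hα : 0 < α)
    (A : Matrix (Fin M) (Fin N) ℝ) (y : Fin M → ℝ)
    (ρlink : ℝ → ℝ) (hA1 : LinkA1 ρlink y)
    (L : (Fin M → ℝ) → (Fin M → ℝ) → ℝ) (hA3 : LossA3 L)
    (T : ℝ≥0∞) (hT : 0 < T) (w : ℝ → Fin N → ℝ)
    (hflow : IsGradFlowOn
      (fun z => L (fun j => ρlink ((A.mulVec fun i => rhoPoly p (z i)) j)) y) T w)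
    (hreg : RegularFlow (rhoPoly p) T w)
    (hinit : ∀ i, rhoPoly p (w 0 i) = α)
    (wT : Fin N → ℝ)
    (hlim : Tendsto (fun t => fun i => rhoPoly p (w t i)) (endFilter T) (𝓝 wT))
    (hfeas : L (fun j => ρlink (A.mulVec wT j)) y = 0)
    (μ : ℝ)
    (hμdef : μ = sInf {c : ℝ |
      ∃ z : Fin N → ℝ, L (fun j => ρlink (A.mulVec z j)) y = 0 ∧ c = lpNorm p z})
    (hαμ : α ≤ μ / (2 ^ ((1 : ℝ) / (p - 1)) * (N : ℝ) ^ ((1 : ℝ) / p))) :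
    lpNorm p wT ≤ (1 + 4 * (N : ℝ) ^ (1 - 1 / p) * (α / μ) ^ (p - 1)) * μ := by
  have hN : 0 < N := by
    rcases Nat.eq_zero_or_pos N with rfl | h
    · rw [Nat.cast_zero, Real.zero_rpow (by positivity), mul_zero, div_zero] at hαμ
      linarith
    · exact h
  have hNR : (0 : ℝ) < N := by exact_mod_cast hN
  have hden : 0 < (2 : ℝ) ^ ((1 : ℝ) / (p - 1)) * (N : ℝ) ^ ((1 : ℝ) / p) := by positivity
  have hαμ' := (le_div_iff₀ hden).mp hαμ
  have hμ : 0 < μ := lt_of_lt_of_le (by positivity) hαμ'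
  have hG : Differentiable ℝ fun v : Fin M → ℝ => L (fun j => ρlink (v j)) y := by
    have h1 : Differentiable ℝ (Function.uncurry L) := hA3.contDiff.differentiable one_ne_zero
    have h2 : Differentiable ℝ ρlink := hA1.contDiff.differentiable one_ne_zero
    have h3 : Differentiable ℝ fun v : Fin M → ℝ => ((fun j => ρlink (v j)), y) := by fun_prop
    exact h1.comp h3
  have hfeas_eq : ∀ z : Fin N → ℝ, L (fun j => ρlink (A.mulVec z j)) y = 0 →
      A.mulVec (wT - z) = 0 := by
    intro z hz
    have h := ((hA3.eq_zero_iff _ _).mp hfeas).trans ((hA3.eq_zero_iff _ _).mp hz).symm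
    rw [Matrix.mulVec_sub, sub_eq_zero]
    ext j
    exact hA1.injective (congrFun h j)
  have hopt : ∀ z : Fin N → ℝ, L (fun j => ρlink (A.mulVec z j)) y = 0 →
      ∑ i, (wT i - z i) * signedPow (p - 1) (wT i) = ∑ i, (wT i - z i) * α ^ (p - 1) := by
    intro z hz
    have := endFilter_neBot (T := T)
    have hl : Tendsto (fun t => ∑ i, (wT i - z i) * signedPow (p - 1) (rhoPoly p (w t i)))
        (endFilter T) (𝓝 (∑ i, (wT i - z i) * signedPow (p - 1) (wT i))) := by
      refine tendsto_finsetSum _ fun i _ => Tendsto.const_mul _ ?_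
      exact ((continuous_signedPow (by linarith)).tendsto _).comp (tendsto_pi_nhds.mp hlim i)
    refine tendsto_nhds_unique hl (tendsto_const_nhds.congr' ?_)
    filter_upwards [eventually_endFilter_mem_domain hT] with t ht
    have hc := sum_mul_signedPow_conserved hp1 hp2 A hG hflow hreg (hfeas_eq z hz) ht.1 ht.2
    simp only [Pi.sub_apply, hinit, signedPow_of_pos hα] at hc
    exact hc.symm
  set X := lpNorm p wT with hX
  set b := α ^ (p - 1) * (N : ℝ) ^ (1 - 1 / p) with hb
  have hX0 : 0 ≤ X := lpNorm_nonneg p wT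
  have hb0 : 0 < b := by positivity
  have hXp0 : 0 ≤ X ^ (p - 1) := Real.rpow_nonneg hX0 _
  have hmain : X ^ p ≤ μ * X ^ (p - 1) + b * (X + μ) := by
    have hpos : 0 < X ^ (p - 1) + b := by linarith
    have hle : (X ^ p - b * X) / (X ^ (p - 1) + b) ≤ μ := by
      rw [hμdef]
      refine le_csInf ⟨_, wT, hfeas, rfl⟩ ?_
      rintro c ⟨z, hz, rfl⟩
      rw [div_le_iff₀ hpos]
      linarith [lpNorm_rpow_le_of_sum_eq hp1 hα (hopt z hz)]
    rw [div_le_iff₀ hpos] at hle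
    linarith
  have hbμ : b ≤ μ ^ (p - 1) / 2 := by
    have h := Real.rpow_le_rpow (by positivity) hαμ' (by linarith : 0 ≤ p - 1)
    rw [Real.mul_rpow hα.le hden.le, Real.mul_rpow (by positivity) (by positivity),
      ← Real.rpow_mul (by norm_num), ← Real.rpow_mul hNR.le, one_div_mul_cancel (by linarith),
      Real.rpow_one, show 1 / p * (p - 1) = 1 - 1 / p by field_simp] at h
    linarith
  have hfin := le_of_rpow_le hp1 hμ hb0.le hbμ hmain
  refine hfin.trans_eq ?_
  rw [hb, Real.div_rpow hα.le hμ.le]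
  ring
end
end

section
/- Let ρ_rp(z) = sinh(z) or ρ_rp(z) = tanh(z), and let w : [0,T) → ℝ^N with T ∈ (0,∞] be any solution of the reparametrized gradient flow under Assumptions (B1), (A3), (B2), where in the tanh case the point z̃₀ in (B2) can be chosen with all entries nonzero. Then w can be extended to a solution w : [0,∞) → ℝ^N, the reparametrized trajectory w̃(t) = ρ_rp(w(t)) converges to some w̃_∞ ∈ D_rp^N with 𝓛̃(w̃_∞) = 0 (where D_rp^N = ℝ^N for sinh and D_rp^N = (−1,1)^N for tanh), and the loss satisfies 𝓛̃(w̃(t)) ≤ D_F(z̃₀, w̃₀)/t for all t > 0. -/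
open Filter Topology Set
open scoped ENNReal

noncomputable section

/-- Inverse hyperbolic tangent on `(-1,1)`. -/
def artanh (x : ℝ) : ℝ := (1 / 2) * Real.log ((1 + x) / (1 - x))

/-- A `C¹` vector field bounded by `B` has integral curves on every interval `[0, τ]`. -/
theorem exists_integralCurve_Icc_of_contDiff_of_bounded {E : Type*} [NormedAddCommGroup E]
    [NormedSpace ℝ E] [FiniteDimensional ℝ E] {f : E → E} (hf : ContDiff ℝ 1 f) {B : ℝ}
    (hB : ∀ x, ‖f x‖ ≤ B) (x₀ : E) {τ : ℝ} (hτ : 0 ≤ τ) :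
    ∃ x : ℝ → E, x 0 = x₀ ∧ ∀ t ∈ Icc 0 τ, HasDerivWithinAt x (f (x t)) (Icc 0 τ) t := by
  have hB0 : 0 ≤ B := (norm_nonneg _).trans (hB x₀)
  lift B to NNReal using hB0
  obtain ⟨K, hK⟩ := hf.contDiffOn.exists_lipschitzOnWith (s := Metric.closedBall x₀ (B * τ))
    one_ne_zero (convex_closedBall _ _) (isCompact_closedBall _ _)
  have hpl : IsPicardLindelof (fun _ : ℝ => f) (tmin := 0) (tmax := τ)
      ⟨0, left_mem_Icc.2 hτ⟩ x₀ (B * τ.toNNReal) 0 B K := by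
    refine .of_time_independent (fun x _ => hB x) ?_ ?_
    · simpa [Real.coe_toNNReal _ hτ] using hK
    · simp [Real.coe_toNNReal _ hτ, hτ]
  exact hpl.exists_eq_forall_mem_Icc_hasDerivWithinAt₀

/-- **Peano's theorem**: a bounded continuous vector field on a finite-dimensional space has
integral curves defined for all nonnegative times. -/
theorem exists_integralCurve_Ici_of_continuous_of_bounded {E : Type*} [NormedAddCommGroup E]
    [NormedSpace ℝ E] [FiniteDimensional ℝ E] {g : E → E} (hg : Continuous g) {R : ℝ}
    (hR : ∀ x, ‖g x‖ ≤ R) (x₀ : E) :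
    ∃ x : ℝ → E, x 0 = x₀ ∧ ∀ t, 0 ≤ t → HasDerivWithinAt x (g (x t)) (Ici 0) t := by
  have hR0 : 0 ≤ R := (norm_nonneg _).trans (hR x₀)
  have hε : ∀ n : ℕ, (0 : ℝ) < 1 / (n + 1) := fun n => Nat.one_div_pos_of_nat
  choose f hf hfg _ using fun n : ℕ =>
    hg.exists_contDiff_approx 1 (ε := fun _ => 1 / (n + 1)) continuous_const fun _ => hε n
  have hfB : ∀ n x, ‖f n x‖ ≤ R + 1 := fun n x => by
    have h1 := hfg n x
    have h2 : (1 : ℝ) / (n + 1) ≤ 1 := by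
      rw [div_le_one (by positivity)]; simp
    have h3 := norm_le_norm_add_norm_sub (g x) (f n x)
    rw [← dist_eq_norm, dist_comm] at h3
    linarith [hR x]
  choose X hX0 hX using fun n : ℕ =>
    exists_integralCurve_Icc_of_contDiff_of_bounded (hf n) (hfB n) x₀ n.cast_nonneg
  have hlip : ∀ n : ℕ, ∀ s ∈ Icc (0 : ℝ) n, ∀ t ∈ Icc (0 : ℝ) n,
      ‖X n t - X n s‖ ≤ (R + 1) * ‖t - s‖ := fun n s hs t ht =>
    (convex_Icc _ _).norm_image_sub_le_of_norm_hasDerivWithin_le (hX n)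
      (fun r _ => hfB n _) hs ht
  let U : Ultrafilter ℕ := hyperfilter ℕ
  have hU : (U : Filter ℕ) ≤ atTop := by
    rw [← Nat.cofinite_eq_atTop]; exact hyperfilter_le_cofinite
  have hev : ∀ t : ℝ, ∀ᶠ n : ℕ in (U : Filter ℕ), t ≤ (n : ℝ) := fun t =>
    hU (tendsto_natCast_atTop_atTop.eventually_ge_atTop t)
  have hlim : ∀ t : ℝ, ∃ p, 0 ≤ t → Tendsto (fun n => X n t) U (𝓝 p) := fun t => by
    by_cases ht : 0 ≤ t
    swap
    · exact ⟨x₀, fun h => absurd h ht⟩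
    have hmem : ∀ᶠ n in (U : Filter ℕ), X n t ∈ Metric.closedBall x₀ ((R + 1) * t) := by
      filter_upwards [hev t] with n hn
      have := hlip n 0 ⟨le_rfl, n.cast_nonneg⟩ t ⟨ht, hn⟩
      rwa [hX0, sub_zero, Real.norm_of_nonneg ht, ← dist_eq_norm] at this
    obtain ⟨p, -, hp⟩ := (isCompact_closedBall x₀ ((R + 1) * t)).ultrafilter_le_nhds'
      (U.map fun n => X n t) hmem
    exact ⟨p, fun _ => hp⟩
  choose x hx using hlim
  refine ⟨x, tendsto_nhds_unique (hx 0 le_rfl) (by simp [hX0]), fun t ht => ?_⟩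
  rw [hasDerivWithinAt_iff_isLittleO, Asymptotics.isLittleO_iff]
  intro ε hε'
  obtain ⟨δ, hδ, hgδ⟩ := Metric.continuous_iff.1 hg (x t) (ε / 2) (half_pos hε')
  have hη : 0 < δ / (2 * (R + 1)) := by positivity
  filter_upwards [inter_mem_nhdsWithin (Ici 0) (Metric.ball_mem_nhds t hη)] with s hs
  have hs0 : 0 ≤ s := hs.1
  have hsη : |s - t| < δ / (2 * (R + 1)) := by simpa [Real.dist_eq] using hs.2
  refine le_of_tendsto (((hx s hs0).sub (hx t ht)).sub_const _).norm ?_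
  have hsmall : ∀ᶠ n : ℕ in (U : Filter ℕ), (1 : ℝ) / (n + 1) < ε / 2 :=
    hU (tendsto_one_div_add_atTop_nhds_zero_nat.eventually_lt_const (half_pos hε'))
  filter_upwards [hev (max s t), hsmall,
    (hx t ht).eventually (Metric.ball_mem_nhds (x t) (half_pos hδ))] with n hn hnε hnt
  have hsn : s ∈ Icc (0 : ℝ) n := ⟨hs0, (le_max_left _ _).trans hn⟩
  have htn : t ∈ Icc (0 : ℝ) n := ⟨ht, (le_max_right _ _).trans hn⟩
  have hsub : uIcc t s ⊆ Icc (0 : ℝ) n := uIcc_subset_Icc htn hsn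
  have key := (convex_uIcc t s).norm_image_sub_le_of_norm_hasDerivWithin_le
    (f := fun r => X n r - r • g (x t)) (f' := fun r => f n (X n r) - g (x t)) (C := ε)
    (fun r hr => by
      have h := ((hX n r (hsub hr)).mono hsub).sub
        ((hasDerivWithinAt_id r _).smul_const (g (x t)))
      rwa [one_smul] at h)
    (fun r hr => by
      have h1 : ‖X n r - X n t‖ ≤ (R + 1) * ‖r - t‖ := hlip n t htn r (hsub hr)
      have h2 : ‖r - t‖ ≤ |s - t| := abs_sub_left_of_mem_uIcc hr
      have h3 : (R + 1) * |s - t| < δ / 2 := by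
        calc (R + 1) * |s - t| < (R + 1) * (δ / (2 * (R + 1))) := by gcongr
          _ = δ / 2 := by field_simp
      have h4 : dist (X n r) (x t) < δ := by
        refine (dist_triangle _ (X n t) _).trans_lt ?_
        have h5 : dist (X n t) (x t) < δ / 2 := hnt
        rw [dist_eq_norm (X n r)]
        have : (R + 1) * ‖r - t‖ ≤ (R + 1) * |s - t| := by gcongr
        linarith
      have h6 := hgδ _ h4
      have h7 := hfg n (X n r)
      rw [← dist_eq_norm]
      have := dist_triangle (f n (X n r)) (g (X n r)) (g (x t))
      linarith)
    left_mem_uIcc right_mem_uIcc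
  have hsplit : X n s - X n t - (s - t) • g (x t) =
      X n s - s • g (x t) - (X n t - t • g (x t)) := by
    rw [sub_smul]
    abel
  rw [hsplit]
  exact key

/-- A function whose derivative along the vector field is nonpositive decreases along curves whose
velocity is a nonnegative multiple of the field. -/
theorem antitoneOn_comp_of_fderiv_nonpos {E : Type*} [NormedAddCommGroup E] [NormedSpace ℝ E]
    {V : E → ℝ} (hV : Differentiable ℝ V) {G : E → E} (hVG : ∀ x, fderiv ℝ V x (G x) ≤ 0)
    {x : ℝ → E} {c : ℝ → ℝ} (hc : ∀ t, 0 ≤ c t) {S : Set ℝ} (hS : Convex ℝ S)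
    (hx : ∀ t ∈ S, HasDerivWithinAt x (c t • G (x t)) S t) :
    AntitoneOn (fun t => V (x t)) S := by
  have hd : ∀ t ∈ S, HasDerivWithinAt (fun t => V (x t)) (c t * fderiv ℝ V (x t) (G (x t))) S t :=
    fun t ht => by
      have h := (hV (x t)).hasFDerivAt.comp_hasDerivWithinAt t (hx t ht)
      rwa [map_smul, smul_eq_mul] at h
  exact antitoneOn_of_hasDerivWithinAt_nonpos hS (fun t ht => (hd t ht).continuousWithinAt)
    (fun t ht => (hd t (interior_subset ht)).mono interior_subset)
    fun t _ => mul_nonpos_of_nonneg_of_nonpos (hc t) (hVG _)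

/-- Global existence of integral curves of a continuous vector field with a Lyapunov function that
has compact sublevel sets. -/
theorem exists_integralCurve_Ici_of_lyapunov {E : Type*} [NormedAddCommGroup E]
    [NormedSpace ℝ E] [FiniteDimensional ℝ E] {V : E → ℝ} (hV : Differentiable ℝ V) {G : E → E}
    (hG : Continuous G) (hVG : ∀ x, fderiv ℝ V x (G x) ≤ 0)
    (hcpt : ∀ C, IsCompact {x | V x ≤ C}) (x₀ : E) :
    ∃ x : ℝ → E, x 0 = x₀ ∧ ∀ t, 0 ≤ t → HasDerivWithinAt x (G (x t)) (Ici 0) t := by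
  obtain ⟨R, hR⟩ := (hcpt (V x₀)).exists_bound_of_continuousOn hG.continuousOn
  set R' := max R 0 + 1 with hR'
  have hR'0 : 0 < R' := by positivity
  let φ : E → ℝ := fun x => R' / max R' ‖G x‖
  have hden : ∀ x, 0 < max R' ‖G x‖ := fun x => lt_max_of_lt_left hR'0
  have hφ0 : ∀ x, 0 ≤ φ x := fun x => div_nonneg hR'0.le (hden x).le
  have hφ : Continuous φ :=
    continuous_const.div (continuous_const.max hG.norm) fun x => (hden x).ne'
  have hbd : ∀ x, ‖φ x • G x‖ ≤ R' := fun x => by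
    rw [norm_smul, Real.norm_of_nonneg (hφ0 x), div_mul_eq_mul_div, div_le_iff₀ (hden x)]
    gcongr
    exact le_max_right _ _
  obtain ⟨x, hx0, hx⟩ := exists_integralCurve_Ici_of_continuous_of_bounded
    (g := fun x => φ x • G x) (hφ.smul hG) hbd x₀
  refine ⟨x, hx0, fun t ht => ?_⟩
  have hanti := antitoneOn_comp_of_fderiv_nonpos hV hVG (fun t => hφ0 (x t)) (convex_Ici 0) hx
  have hle : V (x t) ≤ V x₀ := by
    simpa [hx0] using hanti (mem_Ici.2 le_rfl) ht ht
  have hφ1 : φ (x t) = 1 := by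
    have : ‖G (x t)‖ ≤ R' := (hR _ hle).trans ((le_max_left R 0).trans (by simp [hR']))
    simp [φ, max_eq_left this, hR'0.ne']
  have := hx t ht
  simp only [hφ1, one_smul] at this
  exact this

/-- An integral curve on `[0, T)` of a continuous vector field with a Lyapunov function that has
compact sublevel sets extends to `[0, ∞)`. -/
theorem exists_extension_integralCurve_of_lyapunov {ι : Type*} [Fintype ι] {V : (ι → ℝ) → ℝ}
    (hV : Differentiable ℝ V) {G : (ι → ℝ) → ι → ℝ} (hG : Continuous G)
    (hVG : ∀ x, fderiv ℝ V x (G x) ≤ 0) (hcpt : ∀ C, IsCompact {x | V x ≤ C}) {T : ℝ} (hT : 0 < T)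
    {w : ℝ → ι → ℝ} (hw : ∀ t ∈ Ico 0 T, HasDerivWithinAt w (G (w t)) (Ici 0) t) :
    ∃ x : ℝ → ι → ℝ, (∀ t ∈ Ico 0 T, x t = w t) ∧
      ∀ t, 0 ≤ t → HasDerivWithinAt x (G (x t)) (Ici 0) t := by
  have hw' : ∀ t ∈ Ico 0 T, HasDerivWithinAt w (G (w t)) (Ico 0 T) t := fun t ht =>
    (hw t ht).mono Ico_subset_Ici_self
  have hle : ∀ t ∈ Ico 0 T, V (w t) ≤ V (w 0) := fun t ht =>
    antitoneOn_comp_of_fderiv_nonpos hV hVG (c := fun _ => 1) (fun _ => zero_le_one)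
      (convex_Ico 0 T) (fun t ht => by simpa using hw' t ht) ⟨le_rfl, hT⟩ ht ht.1
  obtain ⟨R, hR⟩ := (hcpt (V (w 0))).exists_bound_of_continuousOn hG.continuousOn
  have hlip : LipschitzOnWith R.toNNReal w (Ico 0 T) :=
    (convex_Ico 0 T).lipschitzOnWith_of_nnnorm_hasDerivWithin_le hw' fun t ht =>
      NNReal.coe_le_coe.1 <| (hR _ (hle t ht)).trans (Real.le_coe_toNNReal R)
  obtain ⟨g, hg, hwg⟩ := hlip.extend_pi
  obtain ⟨z, hz0, hz⟩ := exists_integralCurve_Ici_of_lyapunov hV hG hVG hcpt (g T)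
  let x : ℝ → ι → ℝ := fun t => if t < T then w t else z (t - T)
  have hxw : ∀ t, t < T → x t = w t := fun t ht => if_pos ht
  have hxz : ∀ t, T ≤ t → x t = z (t - T) := fun t ht => if_neg ht.not_gt
  have hxT : x T = g T := by rw [hxz T le_rfl, sub_self, hz0]
  have hbefore : ∀ t ∈ Ico 0 T, HasDerivWithinAt x (G (x t)) (Ici 0) t := fun t ht => by
    rw [hxw t ht.2]
    refine (hw t ht).congr_of_eventuallyEq ?_ (hxw t ht.2)
    filter_upwards [mem_nhdsWithin_of_mem_nhds (Iio_mem_nhds ht.2)] with s hs using hxw s hs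
  have hafter : ∀ t, T ≤ t → HasDerivWithinAt x (G (x t)) (Ici T) t := fun t ht => by
    rw [hxz t ht]
    have h := HasDerivWithinAt.scomp t (hz (t - T) (sub_nonneg.2 ht))
      ((hasDerivWithinAt_id t (Ici T)).sub_const T) fun s hs => sub_nonneg.2 hs
    rw [one_smul] at h
    exact h.congr (fun s hs => hxz s hs) (hxz t ht)
  have hleft : HasDerivWithinAt x (G (x T)) (Iic T) T := by
    have hda : ∀ t ∈ Ioo 0 T, HasDerivAt x (G (x t)) t := fun t ht =>
      (hbefore t ⟨ht.1.le, ht.2⟩).hasDerivAt (Ici_mem_nhds ht.1)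
    have hmem : Ioo 0 T ∈ 𝓝[<] T := Ioo_mem_nhdsLT hT
    have hcont : Tendsto x (𝓝[<] T) (𝓝 (x T)) := by
      rw [hxT]
      refine (hg.continuous.continuousAt.tendsto.mono_left nhdsWithin_le_nhds).congr' ?_
      filter_upwards [hmem] with s hs
      rw [hxw s hs.2, hwg ⟨hs.1.le, hs.2⟩]
    refine hasDerivWithinAt_Iic_of_tendsto_deriv
      (fun t ht => (hda t ht).differentiableAt.differentiableWithinAt)
      (hcont.mono_left (nhdsWithin_mono _ Ioo_subset_Iio_self)) hmem ?_
    refine ((hG.tendsto _).comp hcont).congr' ?_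
    filter_upwards [hmem] with s hs using (hda s hs).deriv.symm
  refine ⟨x, fun t ht => hxw t ht.2, fun t ht => ?_⟩
  rcases lt_trichotomy t T with h | rfl | h
  · exact hbefore t ⟨ht, h⟩
  · have := hleft.union (hafter t le_rfl)
    rw [Iic_union_Ici] at this
    exact this.mono (subset_univ _)
  · exact ((hafter t h.le).hasDerivAt (Ici_mem_nhds h)).hasDerivWithinAt

/-- A convex function lies above its tangent hyperplanes. -/
theorem ConvexOn.fderiv_sub_le {E : Type*} [NormedAddCommGroup E] [NormedSpace ℝ E] {f : E → ℝ}
    (hf : ConvexOn ℝ univ f) {q : E} (hq : DifferentiableAt ℝ f q) (p : E) :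
    fderiv ℝ f q (p - q) ≤ f p - f q := by
  have hc : ConvexOn ℝ univ (f ∘ AffineMap.lineMap (k := ℝ) q p) := hf.comp_affineMap _
  have hd : HasDerivAt (f ∘ AffineMap.lineMap (k := ℝ) q p) (fderiv ℝ f q (p - q)) 0 := by
    refine HasFDerivAt.comp_hasDerivAt (0 : ℝ) ?_ AffineMap.hasDerivAt_lineMap
    simpa using hq.hasFDerivAt
  have h := hc.le_slope_of_hasDerivAt (mem_univ 0) (mem_univ 1) one_pos hd
  simpa [slope_def_field] using h

theorem sum_fderiv_single_mul {ι : Type*} [Fintype ι] [DecidableEq ι] (f : (ι → ℝ) → ℝ)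
    (q u : ι → ℝ) :
    ∑ i, fderiv ℝ f q (Pi.single i 1) * u i = fderiv ℝ f q u := by
  conv_rhs => rw [pi_eq_sum_univ' u, map_sum]
  refine Finset.sum_congr rfl fun i _ => ?_
  rw [map_smul, smul_eq_mul, mul_comm]

/-- `ρ` is a strictly increasing reparametrization with derivative `ρ'`, and `H`, `h` generate the
Bregman divergence of the associated mirror flow: the divergence from `p` to `ρ x` has derivative
`(ρ x - p) / ρ' x` in `x`, and for `p = ρ a` it grows at least linearly away from `a`. -/
structure IsMirrorReparam (ρ ρ' H h : ℝ → ℝ) : Prop where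
  hasDerivAt : ∀ x, HasDerivAt ρ (ρ' x) x
  deriv_pos : ∀ x, 0 < ρ' x
  deriv_continuous : Continuous ρ'
  hasDerivAt_bregman : ∀ p x,
    HasDerivAt (fun x => H p - H (ρ x) - h (ρ x) * (p - ρ x)) ((ρ x - p) / ρ' x) x
  growth : ∀ a, ∃ c, 0 < c ∧ (∀ x, a + 1 ≤ x → c ≤ (ρ x - ρ a) / ρ' x) ∧
    ∀ x, x ≤ a - 1 → (ρ x - ρ a) / ρ' x ≤ -c

namespace IsMirrorReparam

variable {ρ ρ' H h : ℝ → ℝ} (hρ : IsMirrorReparam ρ ρ' H h)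

include hρ

theorem strictMono : StrictMono ρ :=
  strictMono_of_hasDerivAt_pos hρ.hasDerivAt hρ.deriv_pos

theorem continuous : Continuous ρ :=
  continuous_iff_continuousAt.2 fun x => (hρ.hasDerivAt x).continuousAt

theorem coord_pos {a x : ℝ} (hx : x ≠ a) :
    0 < H (ρ a) - H (ρ x) - h (ρ x) * (ρ a - ρ x) := by
  have hd := hρ.hasDerivAt_bregman (ρ a)
  have hc := fun s : Set ℝ => (continuous_iff_continuousAt.2 fun x =>
    (hd x).continuousAt).continuousOn (s := s)
  rcases hx.lt_or_gt with hx | hx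
  · have hanti := strictAntiOn_of_deriv_neg (convex_Iic a) (hc _) fun y hy => by
      rw [interior_Iic] at hy
      rw [(hd y).deriv]
      exact div_neg_of_neg_of_pos (sub_neg.2 (hρ.strictMono hy)) (hρ.deriv_pos y)
    simpa using hanti (mem_Iic.2 hx.le) (mem_Iic.2 le_rfl) hx
  · have hmono := strictMonoOn_of_deriv_pos (convex_Ici a) (hc _) fun y hy => by
      rw [interior_Ici] at hy
      rw [(hd y).deriv]
      exact div_pos (sub_pos.2 (hρ.strictMono hy)) (hρ.deriv_pos y)
    simpa using hmono (mem_Ici.2 le_rfl) (mem_Ici.2 hx.le) hx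

theorem coord_nonneg (a x : ℝ) : 0 ≤ H (ρ a) - H (ρ x) - h (ρ x) * (ρ a - ρ x) := by
  rcases eq_or_ne x a with rfl | hx
  · simp
  · exact (hρ.coord_pos hx).le

theorem exists_coord_growth (a : ℝ) :
    ∃ c, 0 < c ∧ ∀ x, c * (|x - a| - 1) ≤ H (ρ a) - H (ρ x) - h (ρ x) * (ρ a - ρ x) := by
  obtain ⟨c, hc0, hr, hl⟩ := hρ.growth a
  have hd := hρ.hasDerivAt_bregman (ρ a)
  have hc := fun s : Set ℝ => (continuous_iff_continuousAt.2 fun x =>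
    (hd x).continuousAt).continuousOn (s := s)
  have hdiff := fun s : Set ℝ => fun y (_ : y ∈ s) =>
    (hd y).differentiableAt.differentiableWithinAt (s := s)
  refine ⟨c, hc0, fun x => ?_⟩
  rcases le_or_gt (a + 1) x with hx | hx
  · have key := (convex_Ici (a + 1)).mul_sub_le_image_sub_of_le_deriv (hc _) (hdiff _) (C := c)
      (fun y hy => by rw [(hd y).deriv]; exact hr y (interior_subset hy))
      (a + 1) (mem_Ici.2 le_rfl) x hx hx
    have h0 := hρ.coord_nonneg a (a + 1)
    rw [abs_of_nonneg (by linarith)]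
    linarith
  rcases le_or_gt x (a - 1) with hx' | hx'
  · have key := (convex_Iic (a - 1)).image_sub_le_mul_sub_of_deriv_le (hc _) (hdiff _) (C := -c)
      (fun y hy => by rw [(hd y).deriv]; exact hl y (interior_subset (s := Iic (a - 1)) hy))
      x hx' (a - 1) (mem_Iic.2 le_rfl) hx'
    have h0 := hρ.coord_nonneg a (a - 1)
    rw [abs_of_nonpos (by linarith)]
    linarith
  · refine le_trans (mul_nonpos_of_nonneg_of_nonpos hc0.le ?_) (hρ.coord_nonneg a x)
    rw [sub_nonpos, abs_le]
    constructor <;> linarith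

omit hρ in
theorem bregman_eq_sum {k : ℕ} (H h : ℝ → ℝ) (p q : Fin k → ℝ) :
    bregman H h p q = ∑ i, (H (p i) - H (q i) - h (q i) * (p i - q i)) := by
  simp [bregman, Finset.sum_sub_distrib]

theorem bregman_nonneg {k : ℕ} (a x : Fin k → ℝ) :
    0 ≤ bregman H h (fun i => ρ (a i)) fun i => ρ (x i) := by
  rw [bregman_eq_sum]
  exact Finset.sum_nonneg fun i _ => hρ.coord_nonneg _ _

theorem eq_of_bregman_nonpos {k : ℕ} {a x : Fin k → ℝ}
    (hle : bregman H h (fun i => ρ (a i)) (fun i => ρ (x i)) ≤ 0) : x = a := by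
  by_contra hne
  obtain ⟨i, hi⟩ := Function.ne_iff.1 hne
  rw [bregman_eq_sum] at hle
  exact hle.not_gt <| Finset.sum_pos' (fun i _ => hρ.coord_nonneg _ _)
    ⟨i, Finset.mem_univ i, hρ.coord_pos hi⟩

theorem hasFDerivAt_bregman {k : ℕ} (p x : Fin k → ℝ) :
    HasFDerivAt (fun x : Fin k → ℝ => bregman H h p fun i => ρ (x i))
      (∑ i, ((ρ (x i) - p i) / ρ' (x i)) • (ContinuousLinearMap.proj i : (Fin k → ℝ) →L[ℝ] ℝ))
      x := by
  simp only [bregman_eq_sum]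
  exact HasFDerivAt.fun_sum fun i _ =>
    (hρ.hasDerivAt_bregman (p i) (x i)).comp_hasFDerivAt (f := fun x : Fin k → ℝ => x i) x
      (hasFDerivAt_apply i x)

theorem continuous_bregman {k : ℕ} (p : Fin k → ℝ) :
    Continuous fun x : Fin k → ℝ => bregman H h p fun i => ρ (x i) :=
  continuous_iff_continuousAt.2 fun x => (hρ.hasFDerivAt_bregman p x).continuousAt

theorem isCompact_sublevel_bregman {k : ℕ} (a : Fin k → ℝ) (C : ℝ) :
    IsCompact {x : Fin k → ℝ | bregman H h (fun i => ρ (a i)) (fun i => ρ (x i)) ≤ C} := by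
  choose c hc0 hc using fun i => hρ.exists_coord_growth (a i)
  refine (isCompact_univ_pi fun i => isCompact_closedBall (a i) (C / c i + 1)).of_isClosed_subset
    (isClosed_le (hρ.continuous_bregman _) continuous_const) fun x hx i _ => ?_
  rw [mem_ofPred_eq, bregman_eq_sum] at hx
  have h1 := (Finset.single_le_sum (f := fun i => H (ρ (a i)) - H (ρ (x i)) -
    h (ρ (x i)) * (ρ (a i) - ρ (x i))) (fun i _ => hρ.coord_nonneg _ _)
    (Finset.mem_univ i)).trans hx
  rw [Metric.mem_closedBall, Real.dist_eq, ← sub_le_iff_le_add, le_div_iff₀' (hc0 i)]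
  exact (hc i (x i)).trans h1

variable {k : ℕ} {f : (Fin k → ℝ) → ℝ}

theorem hasFDerivAt_comp (hf : Differentiable ℝ f) (x : Fin k → ℝ) :
    HasFDerivAt (fun x : Fin k → ℝ => f fun i => ρ (x i))
      ((fderiv ℝ f fun i => ρ (x i)).comp
        (ContinuousLinearMap.pi fun i => ρ' (x i) • ContinuousLinearMap.proj i)) x :=
  (hf _).hasFDerivAt.comp x <| hasFDerivAt_pi.2 fun i =>
    (hρ.hasDerivAt (x i)).comp_hasFDerivAt x (hasFDerivAt_apply i x)

theorem grad_comp (hf : Differentiable ℝ f) (x : Fin k → ℝ) (i : Fin k) :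
    grad (fun x => f fun i => ρ (x i)) x i =
      fderiv ℝ f (fun i => ρ (x i)) (Pi.single i 1) * ρ' (x i) := by
  have hs : (fun j => ρ' (x j) * (Pi.single i 1 : Fin k → ℝ) j) =
      ρ' (x i) • (Pi.single i 1 : Fin k → ℝ) := by
    ext j
    rcases eq_or_ne j i with rfl | hj
    · simp
    · simp [hj]
  rw [grad, (hρ.hasFDerivAt_comp hf x).fderiv, mul_comm, ← smul_eq_mul, ← map_smul, ← hs]
  rfl

theorem continuous_grad_comp (hf : ContDiff ℝ 1 f) :
    Continuous (grad fun x => f fun i => ρ (x i)) := by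
  refine continuous_pi fun i => ?_
  simp only [hρ.grad_comp (hf.differentiable one_ne_zero)]
  have h1 : Continuous fun x : Fin k → ℝ => fun i => ρ (x i) :=
    continuous_pi fun i => hρ.continuous.comp (continuous_apply i)
  exact (((hf.continuous_fderiv one_ne_zero).comp h1).clm_apply continuous_const).mul
    (hρ.deriv_continuous.comp (continuous_apply i))

theorem fderiv_bregman_neg_grad_le (hf : Differentiable ℝ f) (hconv : ConvexOn ℝ univ f)
    (p x : Fin k → ℝ) :
    fderiv ℝ (fun x : Fin k → ℝ => bregman H h p fun i => ρ (x i)) x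
      (-grad (fun x => f fun i => ρ (x i)) x) ≤ f p - f fun i => ρ (x i) := by
  refine le_trans (le_of_eq ?_) (hconv.fderiv_sub_le (hf _) p)
  rw [(hρ.hasFDerivAt_bregman p x).fderiv, ← sum_fderiv_single_mul f _ (p - _)]
  simp only [FunLike.coe_sum, Finset.sum_apply, FunLike.coe_smul,
    Pi.smul_apply, ContinuousLinearMap.proj_apply, Pi.neg_apply, hρ.grad_comp hf, smul_eq_mul,
    Pi.sub_apply]
  refine Finset.sum_congr rfl fun i _ => ?_
  have := (hρ.deriv_pos (x i)).ne'
  field_simp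
  ring

omit hρ in
theorem fderiv_neg_grad_nonpos (F : (Fin k → ℝ) → ℝ) (x : Fin k → ℝ) :
    fderiv ℝ F x (-grad F x) ≤ 0 := by
  rw [map_neg, neg_nonpos, ← sum_fderiv_single_mul F x (grad F x)]
  exact Finset.sum_nonneg fun i _ => mul_self_nonneg _

theorem exists_extension (hf : ContDiff ℝ 1 f) (hconv : ConvexOn ℝ univ f) (hf0 : ∀ z, 0 ≤ f z)
    {a : Fin k → ℝ} (ha : f (fun i => ρ (a i)) = 0) {T : ℝ≥0∞} (hT : 0 < T)
    {w : ℝ → Fin k → ℝ} (hw : IsGradFlowOn (fun x => f fun i => ρ (x i)) T w) :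
    ∃ x : ℝ → Fin k → ℝ, IsGradFlowOn (fun x => f fun i => ρ (x i)) ⊤ x ∧
      ∀ t, 0 ≤ t → ENNReal.ofReal t < T → x t = w t := by
  rcases eq_or_ne T ⊤ with rfl | hTtop
  · exact ⟨w, hw, fun _ _ _ => rfl⟩
  have hiff : ∀ t, 0 ≤ t → (ENNReal.ofReal t < T ↔ t < T.toReal) := fun t ht =>
    ENNReal.ofReal_lt_iff_lt_toReal ht hTtop
  obtain ⟨x, hxw, hx⟩ := exists_extension_integralCurve_of_lyapunov
    (fun x => (hρ.hasFDerivAt_bregman (fun i => ρ (a i)) x).differentiableAt)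
    (hρ.continuous_grad_comp hf).neg
    (fun x => (hρ.fderiv_bregman_neg_grad_le (hf.differentiable one_ne_zero) hconv _ x).trans
      (by rw [ha, zero_sub]; exact neg_nonpos.2 (hf0 _)))
    (hρ.isCompact_sublevel_bregman a) (ENNReal.toReal_pos hT.ne' hTtop)
    fun t ht => hw t ht.1 ((hiff t ht.1).2 ht.2)
  exact ⟨x, fun t ht _ => hx t ht, fun t ht htT => hxw t ⟨ht, (hiff t ht).1 htT⟩⟩

theorem antitoneOn_bregman (hf : ContDiff ℝ 1 f) (hconv : ConvexOn ℝ univ f) (hf0 : ∀ z, 0 ≤ f z)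
    {p : Fin k → ℝ} (hp : f p = 0) {x : ℝ → Fin k → ℝ}
    (hx : IsGradFlowOn (fun x => f fun i => ρ (x i)) ⊤ x) :
    AntitoneOn (fun t => bregman H h p fun i => ρ (x t i)) (Ici 0) :=
  antitoneOn_comp_of_fderiv_nonpos (V := fun x : Fin k → ℝ => bregman H h p fun i => ρ (x i))
    (fun x => (hρ.hasFDerivAt_bregman p x).differentiableAt)
    (fun x => (hρ.fderiv_bregman_neg_grad_le (hf.differentiable one_ne_zero) hconv p x).trans
      (by rw [hp, zero_sub]; exact neg_nonpos.2 (hf0 _)))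
    (c := fun _ => 1) (fun _ => zero_le_one) (convex_Ici 0)
    fun t ht => by simpa using hx t ht ENNReal.ofReal_lt_top

theorem loss_le_bregman_div (hf : ContDiff ℝ 1 f) (hconv : ConvexOn ℝ univ f)
    {a : Fin k → ℝ} (ha : f (fun i => ρ (a i)) = 0)
    {x : ℝ → Fin k → ℝ} (hx : IsGradFlowOn (fun x => f fun i => ρ (x i)) ⊤ x) {t : ℝ}
    (ht : 0 < t) :
    f (fun i => ρ (x t i)) ≤
      bregman H h (fun i => ρ (a i)) (fun i => ρ (x 0 i)) / t := by
  have hdf := hf.differentiable one_ne_zero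
  set F : (Fin k → ℝ) → ℝ := fun x => f fun i => ρ (x i) with hF
  set V : (Fin k → ℝ) → ℝ := fun x => bregman H h (fun i => ρ (a i)) fun i => ρ (x i) with hV
  have hd : ∀ t ∈ Ici (0 : ℝ), HasDerivWithinAt (fun t => V (x t) + t * F (x t))
      (fderiv ℝ V (x t) (-grad F (x t)) +
        (1 * F (x t) + t * fderiv ℝ F (x t) (-grad F (x t)))) (Ici 0) t := fun t ht => by
    have hxt := hx t ht ENNReal.ofReal_lt_top
    have h1 := (hρ.hasFDerivAt_bregman (fun i => ρ (a i))
      (x t)).differentiableAt.hasFDerivAt.comp_hasDerivWithinAt t hxt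
    have h2 := (hρ.hasFDerivAt_comp hdf
      (x t)).differentiableAt.hasFDerivAt.comp_hasDerivWithinAt t hxt
    exact h1.add ((hasDerivWithinAt_id t _).mul h2)
  have hanti := antitoneOn_of_hasDerivWithinAt_nonpos (convex_Ici 0)
    (fun t ht => (hd t ht).continuousWithinAt)
    (fun t ht => (hd t (interior_subset ht)).mono interior_subset) fun t ht => by
      have ht0 : 0 ≤ t := interior_subset ht
      have h1 := hρ.fderiv_bregman_neg_grad_le hdf hconv (fun i => ρ (a i)) (x t)
      have h2 := mul_nonpos_of_nonneg_of_nonpos ht0 (fderiv_neg_grad_nonpos F (x t))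
      rw [ha] at h1
      change fderiv ℝ V (x t) (-grad F (x t)) ≤ 0 - F (x t) at h1
      linarith
  have key := hanti (mem_Ici.2 le_rfl) (mem_Ici.2 ht.le) ht.le
  have hnn : 0 ≤ V (x t) := hρ.bregman_nonneg a (x t)
  simp only [zero_mul, add_zero] at key
  rw [le_div_iff₀' ht]
  change t * F (x t) ≤ V (x 0)
  linarith

theorem exists_tendsto (hf : ContDiff ℝ 1 f) (hconv : ConvexOn ℝ univ f) (hf0 : ∀ z, 0 ≤ f z)
    {a : Fin k → ℝ} (ha : f (fun i => ρ (a i)) = 0)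
    {x : ℝ → Fin k → ℝ} (hx : IsGradFlowOn (fun x => f fun i => ρ (x i)) ⊤ x) :
    ∃ v : Fin k → ℝ, Tendsto x atTop (𝓝 v) ∧ f (fun i => ρ (v i)) = 0 := by
  have hρc : Continuous fun x : Fin k → ℝ => fun i => ρ (x i) :=
    continuous_pi fun i => hρ.continuous.comp (continuous_apply i)
  have hK := hρ.isCompact_sublevel_bregman a
    (bregman H h (fun i => ρ (a i)) fun i => ρ (x 0 i))
  have hmem : ∀ᶠ t in atTop, x t ∈ {z : Fin k → ℝ | bregman H h (fun i => ρ (a i))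
      (fun i => ρ (z i)) ≤ bregman H h (fun i => ρ (a i)) fun i => ρ (x 0 i)} := by
    filter_upwards [eventually_ge_atTop 0] with t ht
    exact hρ.antitoneOn_bregman hf hconv hf0 ha hx (mem_Ici.2 le_rfl) ht ht
  obtain ⟨v, -, hv⟩ := hK.exists_mapClusterPt_of_frequently hmem.frequently
  set B := bregman H h (fun i => ρ (a i)) fun i => ρ (x 0 i)
  have hloss : Tendsto (fun t => f fun i => ρ (x t i)) atTop (𝓝 0) := by
    refine squeeze_zero' (g := fun t => B / t) (Eventually.of_forall fun t => hf0 _) ?_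
      (tendsto_const_nhds.div_atTop tendsto_id)
    filter_upwards [eventually_gt_atTop 0] with t ht
    exact hρ.loss_le_bregman_div hf hconv ha hx ht
  have hv0 : f (fun i => ρ (v i)) = 0 := by
    have h1 := hv.tendsto_comp ((hf.continuous.comp hρc).tendsto v)
    exact eq_of_nhds_neBot (h1.clusterPt.mono hloss)
  refine ⟨v, hK.tendsto_nhds_of_unique_mapClusterPt hmem fun u _ hu => ?_, hv0⟩
  have hVc := hρ.continuous_bregman fun i => ρ (v i)
  have hVanti := hρ.antitoneOn_bregman hf hconv hf0 hv0 hx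
  refine hρ.eq_of_bregman_nonpos (le_of_forall_pos_le_add fun ε hε => ?_)
  have hsmall := hv.frequently ((hVc.tendsto v).eventually_lt_const (u := ε)
    (by simpa [bregman] using hε))
  obtain ⟨s, hs, hs0⟩ := (hsmall.and_eventually (eventually_ge_atTop 0)).exists
  rw [zero_add]
  refine (isClosed_le hVc continuous_const).mem_of_mapClusterPt hu ?_
  filter_upwards [eventually_ge_atTop s] with t ht
  exact (hVanti (mem_Ici.2 hs0) (mem_Ici.2 (hs0.trans ht)) ht).trans hs.le

end IsMirrorReparam

theorem isMirrorReparam_sinh : IsMirrorReparam Real.sinh Real.cosh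
    (fun z => z * Real.arctan z - (1 / 2) * Real.log (1 + z ^ 2)) Real.arctan where
  hasDerivAt := Real.hasDerivAt_sinh
  deriv_pos := Real.cosh_pos
  deriv_continuous := Real.continuous_cosh
  hasDerivAt_bregman p x := by
    have hpos : 0 < 1 + Real.sinh x ^ 2 := by positivity
    have hs := Real.hasDerivAt_sinh x
    have hl : HasDerivAt (fun x => Real.log (1 + Real.sinh x ^ 2))
        (2 * Real.sinh x * Real.cosh x / (1 + Real.sinh x ^ 2)) x := by
      simpa using ((hs.pow 2).const_add 1).log hpos.ne'
    have hd := ((hl.const_mul (1 / 2)).const_add (p * Real.arctan p -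
      1 / 2 * Real.log (1 + p ^ 2))).sub (hs.arctan.mul_const p)
    have hc := Real.cosh_pos x
    refine (hd.congr_deriv ?_).congr_of_eventuallyEq (.of_forall fun y => ?_)
    · have hsq : 1 + Real.sinh x ^ 2 = Real.cosh x ^ 2 := by rw [Real.cosh_sq]; ring
      rw [hsq]
      field_simp
    · simp only [Pi.sub_apply]
      ring
  growth a := by
    have he : Real.exp (-1) < 1 := Real.exp_lt_one_iff.2 (by norm_num)
    have hstep : ∀ u v : ℝ, u + 1 ≤ v → Real.exp u ≤ Real.exp (-1) * Real.exp v := fun u v huv => by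
      rw [← Real.exp_add]
      exact Real.exp_le_exp.2 (by linarith)
    refine ⟨1 - Real.exp (-1), by linarith, fun x hx => ?_, fun x hx => ?_⟩
    · rw [le_div_iff₀ (Real.cosh_pos x), Real.sinh_eq, Real.sinh_eq, Real.cosh_eq]
      have h1 := hstep a x hx
      have h2 := hstep (-x) (-a) (by linarith)
      have h3 : Real.exp (-x) ≤ Real.exp (-a) := Real.exp_le_exp.2 (by linarith)
      nlinarith
    · rw [div_le_iff₀ (Real.cosh_pos x), Real.sinh_eq, Real.sinh_eq, Real.cosh_eq]
      have h1 := hstep x a (by linarith)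
      have h2 := hstep (-a) (-x) (by linarith)
      have h3 : Real.exp x ≤ Real.exp a := Real.exp_le_exp.2 (by linarith)
      nlinarith

theorem artanh_tanh (x : ℝ) : artanh (Real.tanh x) = x := by
  rw [artanh, ← Real.artanh_eq_half_log ⟨(Real.neg_one_lt_tanh x).le, (Real.tanh_lt_one x).le⟩,
    Real.artanh_tanh]

theorem hasDerivAt_real_tanh (x : ℝ) : HasDerivAt Real.tanh (1 / Real.cosh x ^ 2) x := by
  have h := (Real.hasDerivAt_sinh x).div (Real.hasDerivAt_cosh x) (Real.cosh_pos x).ne'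
  have heq : Real.tanh = Real.sinh / Real.cosh := funext Real.tanh_eq_sinh_div_cosh
  rw [heq]
  refine h.congr_deriv ?_
  congr 1
  linarith [Real.cosh_sq x]

theorem isMirrorReparam_tanh : IsMirrorReparam Real.tanh (fun x => 1 / Real.cosh x ^ 2)
    (fun z => (1 / 2) * (z * artanh z)) fun z => (1 / 2) * (artanh z + z / (1 - z ^ 2)) where
  hasDerivAt := hasDerivAt_real_tanh
  deriv_pos x := by have := Real.cosh_pos x; positivity
  deriv_continuous := continuous_const.div (Real.continuous_cosh.pow 2) fun x =>
    (pow_pos (Real.cosh_pos x) 2).ne'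
  hasDerivAt_bregman p x := by
    have hquot : ∀ y, Real.tanh y / (1 - Real.tanh y ^ 2) = Real.sinh y * Real.cosh y := fun y => by
      have hc := (Real.cosh_pos y).ne'
      have h1 : 1 - Real.tanh y ^ 2 = 1 / Real.cosh y ^ 2 := by
        rw [Real.tanh_eq_sinh_div_cosh]
        field_simp
        linarith [Real.cosh_sq y]
      rw [h1, Real.tanh_eq_sinh_div_cosh]
      field_simp
    simp only [artanh_tanh, hquot]
    have ht := hasDerivAt_real_tanh x
    have hd := (((ht.mul (hasDerivAt_id x)).const_mul (1 / 2)).const_sub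
      (1 / 2 * (p * artanh p))).sub
      ((((hasDerivAt_id x).add ((Real.hasDerivAt_sinh x).mul (Real.hasDerivAt_cosh x))).const_mul
        (1 / 2)).mul (ht.const_sub p))
    refine hd.congr_deriv ?_
    have hc := (Real.cosh_pos x).ne'
    simp only [id, Pi.add_apply, Pi.mul_apply, Real.tanh_eq_sinh_div_cosh]
    field_simp
    have hsq := Real.cosh_sq x
    have hs2 : Real.sinh x ^ 2 = Real.cosh x ^ 2 - 1 := by linarith
    ring_nf
    simp only [hs2]
    linear_combination (Real.cosh x * Real.sinh x) * hs2
  growth a := by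
    have hmono : StrictMono Real.tanh := strictMono_of_hasDerivAt_pos hasDerivAt_real_tanh fun x =>
      by have := Real.cosh_pos x; positivity
    have h1 := sub_pos.2 (hmono (lt_add_one a))
    have h2 := sub_pos.2 (hmono (sub_one_lt a))
    have hcosh : ∀ x, 1 ≤ Real.cosh x ^ 2 := fun x => one_le_pow₀ (Real.one_le_cosh x)
    refine ⟨min (Real.tanh (a + 1) - Real.tanh a) (Real.tanh a - Real.tanh (a - 1)),
      lt_min h1 h2, fun x hx => ?_, fun x hx => ?_⟩
    · refine (min_le_left _ _).trans ?_
      have h3 := hmono.monotone hx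
      rw [div_div_eq_mul_div, div_one]
      nlinarith [hcosh x]
    · rw [le_neg]
      refine (min_le_right _ _).trans ?_
      have h3 := hmono.monotone hx
      rw [div_div_eq_mul_div, div_one]
      nlinarith [hcosh x]

/-- Convergence of the `sinh`- and `tanh`-reparametrized gradient flows:
global extension, convergence of the reparametrized trajectory to a global minimizer, and a
`D_F(z̃₀, w̃₀)/t` rate for the loss. -/
theorem statement16 {N M : ℕ} (ρ : ℝ → ℝ) (D : Set ℝ) (Hf hf : ℝ → ℝ)
    (A : Matrix (Fin M) (Fin N) ℝ) (y : Fin M → ℝ)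
    (L : (Fin M → ℝ) → (Fin M → ℝ) → ℝ) (hA3 : LossA3 L)
    (zt0 : Fin N → ℝ) (hzt0mem : ∀ i, zt0 i ∈ D) (hzt0 : A.mulVec zt0 = y)
    (hcase :
      (ρ = Real.sinh ∧ D = Set.univ ∧ hf = Real.arctan ∧
        Hf = fun z => z * Real.arctan z - (1 / 2) * Real.log (1 + z ^ 2)) ∨
      (ρ = Real.tanh ∧ D = Set.Ioo (-1 : ℝ) 1 ∧
        hf = (fun z => (1 / 2) * (artanh z + z / (1 - z ^ 2))) ∧
        Hf = (fun z => (1 / 2) * (z * artanh z)) ∧ ∀ i, zt0 i ≠ 0))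
    (T : ℝ≥0∞) (hT : 0 < T) (w : ℝ → Fin N → ℝ)
    (hflow : IsGradFlowOn (fun z => L (A.mulVec fun i => ρ (z i)) y) T w) :
    ∃ w2 : ℝ → Fin N → ℝ,
      IsGradFlowOn (fun z => L (A.mulVec fun i => ρ (z i)) y) ⊤ w2 ∧
      (∀ t : ℝ, 0 ≤ t → ENNReal.ofReal t < T → w2 t = w t) ∧
      ∃ winf : Fin N → ℝ, (∀ i, winf i ∈ D) ∧
        Tendsto (fun t => fun i => ρ (w2 t i)) atTop (𝓝 winf) ∧
        L (A.mulVec winf) y = 0 ∧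
        ∀ t : ℝ, 0 < t →
          L (A.mulVec fun i => ρ (w2 t i)) y ≤
            bregman Hf hf zt0 (fun i => ρ (w2 0 i)) / t := by
  obtain ⟨ρ', hρ, hrange, hDmem⟩ : ∃ ρ', IsMirrorReparam ρ ρ' Hf hf ∧
      (∀ z ∈ D, ∃ x, ρ x = z) ∧ ∀ x, ρ x ∈ D := by
    rcases hcase with ⟨rfl, rfl, rfl, rfl⟩ | ⟨rfl, rfl, rfl, rfl, -⟩
    · exact ⟨_, isMirrorReparam_sinh, fun z _ => Real.sinh_surjective z, fun _ => mem_univ _⟩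
    · exact ⟨_, isMirrorReparam_tanh, fun z hz => ⟨Real.artanh z, Real.tanh_artanh hz⟩,
        fun x => ⟨Real.neg_one_lt_tanh x, Real.tanh_lt_one x⟩⟩
  choose a ha using fun i => hrange (zt0 i) (hzt0mem i)
  obtain rfl : (fun i => ρ (a i)) = zt0 := funext ha
  let f : (Fin N → ℝ) → ℝ := fun z => L (A.mulVec z) y
  have hf1 : ContDiff ℝ 1 f :=
    hA3.contDiff.comp ((Matrix.mulVecLin A).toContinuousLinearMap.contDiff.prodMk contDiff_const)
  have hconv : ConvexOn ℝ univ f := (hA3.convexOn_fst y).comp_linearMap (Matrix.mulVecLin A)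
  have hf0 : ∀ z, 0 ≤ f z := fun z => hA3.nonneg _ _
  have hfa : f (fun i => ρ (a i)) = 0 := (hA3.eq_zero_iff _ _).2 hzt0
  obtain ⟨w2, hw2, hww2⟩ := hρ.exists_extension hf1 hconv hf0 hfa hT hflow
  obtain ⟨v, hv, hfv⟩ := hρ.exists_tendsto hf1 hconv hf0 hfa hw2
  refine ⟨w2, hw2, hww2, fun i => ρ (v i), fun i => hDmem _, tendsto_pi_nhds.2 fun i =>
    (hρ.continuous.tendsto _).comp (tendsto_pi_nhds.1 hv i), hfv, fun t ht =>
    hρ.loss_le_bregman_div hf1 hconv hfa hw2 ht⟩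
end
end
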